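/- arXiv:1502.07118 — 2 statements merged into one kernel-verified Lean document; each statement's English description precedes it below -/
import Mathlib

section
/- Compositionality of local linearizability: a concurrent history h over a set O of objects, each object q ∈ O having a container alphabet Σ_q and a sequential specification S_q, is locally linearizable over O if and only if for every object q ∈ O the projection h|q is locally linearizable with respect to S_q. -/
namespace LL

universe u v w

/-- Method calls of a container alphabet: insertions `ins x` of a value `x ∈ V`,
and removals `rem v` of a value `v ∈ V` or returning an "empty" value in `E`. -/
inductive CMethod (V : Type u) (E : Type v) where
  | ins : V → CMethod V E
  | rem : V ⊕ E → CMethod V E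

/-- Events of a concurrent history: invocations and responses of method calls
in `σ`, tagged with a thread identifier in `I`. -/
inductive Event (σ : Type u) (I : Type v) where
  | inv : σ → I → Event σ I
  | res : σ → I → Event σ I

variable {σ : Type*} {I : Type*} {V : Type*} {E : Type*} {α : Type*}

/-- The method call of an event. -/
def Event.method : Event σ I → σ
  | .inv m _ => m
  | .res m _ => m

/-- The thread identifier of an event. -/
def Event.thread : Event σ I → I
  | .inv _ k => k
  | .res _ k => k

/-- Whether an event is an invocation. -/
def Event.isInv : Event σ I → Bool
  | .inv _ _ => true
  | .res _ _ => false

/-- `a` occurs (strictly) before `b` in the sequence `s`. -/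
def OccursBefore (s : List α) (a b : α) : Prop :=
  ∃ i j : Fin s.length, i < j ∧ s.get i = a ∧ s.get j = b

/-- A set of sequences is prefix-closed. -/
def PrefixClosed (S : Set (List α)) : Prop :=
  ∀ s ∈ S, ∀ t : List α, t <+: s → t ∈ S

open Classical in
/-- The subsequence of events of thread `k`. -/
noncomputable def threadEvents (h : List (Event σ I)) (k : I) : List (Event σ I) :=
  h.filter fun e => decide (e.thread = k)

/-- `h` is a well-formed concurrent history: no event occurs twice, each method
call is invoked at most once, every response is preceded by its matching
invocation, and in every thread's subsequence of events each invocation is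
immediately followed by its matching response. -/
structure IsHistory (h : List (Event σ I)) : Prop where
  nodup : h.Nodup
  invUnique : ∀ (i j : Fin h.length) (m : σ) (k k' : I),
      h.get i = Event.inv m k → h.get j = Event.inv m k' → i = j
  resMatched : ∀ (j : Fin h.length) (m : σ) (k : I), h.get j = Event.res m k →
      ∃ i : Fin h.length, i < j ∧ h.get i = Event.inv m k
  threadSeq : ∀ (k : I) (i : ℕ) (m : σ),
      (threadEvents h k)[i]? = some (Event.inv m k) →
      ∀ e : Event σ I, (threadEvents h k)[i + 1]? = some e → e = Event.res m k

/-- The method call `m` appears in `h` (its invocation occurs in `h`). -/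
def Appears (h : List (Event σ I)) (m : σ) : Prop :=
  ∃ k : I, Event.inv m k ∈ h

/-- `h` is complete: every invocation has its matching response in `h`. -/
def HistComplete (h : List (Event σ I)) : Prop :=
  ∀ (m : σ) (k : I), Event.inv m k ∈ h → Event.res m k ∈ h

/-- The method call `m` (executed by thread `k`) is pending in `h`. -/
def PendingCall (h : List (Event σ I)) (m : σ) (k : I) : Prop :=
  Event.inv m k ∈ h ∧ Event.res m k ∉ h

/-- `hc` is a completion of `h`: a complete well-formed history obtained from `h`
by deleting some pending invocations and appending matching responses for the
remaining pending invocations. -/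
def IsCompletionOf (hc h : List (Event σ I)) : Prop :=
  IsHistory hc ∧ HistComplete hc ∧
  ∃ h' r : List (Event σ I),
    h'.Sublist h ∧
    (∀ e ∈ h, e ∉ h' → ∃ (m : σ) (k : I), e = Event.inv m k ∧ PendingCall h m k) ∧
    (∀ e ∈ r, ∃ (m : σ) (k : I), e = Event.res m k ∧ PendingCall h m k) ∧
    hc = h' ++ r

/-- The precedence order of `h`: `m <_h n` iff the response of `m` occurs in `h`
before the invocation of `n`. -/
def Precedes (h : List (Event σ I)) (m n : σ) : Prop :=
  ∃ (i j : Fin h.length) (k k' : I),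
    i < j ∧ h.get i = Event.res m k ∧ h.get j = Event.inv n k'

/-- The sequence of method calls of a history (in invocation order). -/
def methodList (h : List (Event σ I)) : List σ :=
  (h.filter Event.isInv).map Event.method

/-- `h` is linearizable wrt the sequential specification `S`. -/
def Linearizable (S : Set (List σ)) (h : List (Event σ I)) : Prop :=
  ∃ hc : List (Event σ I), IsCompletionOf hc h ∧
    ∃ s ∈ S, s.Perm (methodList hc) ∧
      ∀ m n : σ, Precedes hc m n → OccursBefore s m n

/-- `h` is sequentially consistent wrt `S`. -/
def SeqConsistent (S : Set (List σ)) (h : List (Event σ I)) : Prop :=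
  ∃ hc : List (Event σ I), IsCompletionOf hc h ∧
    ∃ s ∈ S, s.Perm (methodList hc) ∧
      ∀ m n : σ, Precedes hc m n →
        (∃ k : I, Event.inv m k ∈ hc ∧ Event.inv n k ∈ hc) →
        OccursBefore s m n

/-- Position `p` is a quiescent state of `h`: every invocation occurring before
position `p` has its matching response before position `p`. -/
def QuiescentAt (h : List (Event σ I)) (p : ℕ) : Prop :=
  ∀ (i : Fin h.length) (m : σ) (k : I), (i : ℕ) < p → h.get i = Event.inv m k →
    ∃ j : Fin h.length, (j : ℕ) < p ∧ h.get j = Event.res m k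

/-- `h` is quiescently consistent wrt `S`. -/
def QuiescentConsistent (S : Set (List σ)) (h : List (Event σ I)) : Prop :=
  ∃ hc : List (Event σ I), IsCompletionOf hc h ∧
    ∃ s ∈ S, s.Perm (methodList hc) ∧
      ∀ m n : σ,
        (∃ p : ℕ, QuiescentAt hc p ∧
          (∃ (i : Fin hc.length) (k : I), (i : ℕ) < p ∧ hc.get i = Event.res m k) ∧
          (∃ (j : Fin hc.length) (k : I), p ≤ (j : ℕ) ∧ hc.get j = Event.inv n k)) →
        OccursBefore s m n

/-- Membership of a method call in `I_T ∪ O_T`: insertions performed by thread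
`T` in `h`, removals of values inserted by `T` in `h`, and removals returning an
"empty" value. -/
def InducedMethod (h : List (Event (CMethod V E) I)) (T : I) : CMethod V E → Prop
  | .ins x => Event.inv (CMethod.ins x) T ∈ h
  | .rem (Sum.inl x) => Event.inv (CMethod.ins x) T ∈ h
  | .rem (Sum.inr _) => True

open Classical in
/-- The thread-induced history `h_T`: the subsequence of `h` of events of method
calls in `I_T ∪ O_T`. -/
noncomputable def threadInduced (h : List (Event (CMethod V E) I)) (T : I) :
    List (Event (CMethod V E) I) :=
  h.filter fun e => decide (InducedMethod h T e.method)

/-- `h` is locally linearizable wrt `S`: every thread-induced history is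
linearizable wrt `S`, and the thread-induced histories decompose `h`. -/
def LocallyLinearizable (S : Set (List (CMethod V E)))
    (h : List (Event (CMethod V E) I)) : Prop :=
  (∀ T : I, Linearizable S (threadInduced h T)) ∧
  (∀ m : CMethod V E, Appears h m → ∃ T : I, InducedMethod h T m)

/-- The pool sequential specification `S_P`. -/
def poolSpec (V : Type u) (E : Type v) : Set (List (CMethod V E)) :=
  { s | s.Nodup ∧
    (∀ x : V, CMethod.rem (Sum.inl x) ∈ s →
      CMethod.ins x ∈ s ∧
      OccursBefore s (CMethod.ins x) (CMethod.rem (Sum.inl x))) ∧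
    (∀ (e : E) (x : V),
      OccursBefore s (CMethod.ins x) (CMethod.rem (Sum.inr e)) →
      CMethod.rem (Sum.inl x) ∈ s ∧
      OccursBefore s (CMethod.rem (Sum.inl x)) (CMethod.rem (Sum.inr e))) }

/-- The queue sequential specification `S_Q` (pool axioms plus queue order). -/
def queueSpec (V : Type u) (E : Type v) : Set (List (CMethod V E)) :=
  { s | s ∈ poolSpec V E ∧
    ∀ x y : V, OccursBefore s (CMethod.ins x) (CMethod.ins y) →
      CMethod.rem (Sum.inl y) ∈ s →
      CMethod.rem (Sum.inl x) ∈ s ∧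
      OccursBefore s (CMethod.rem (Sum.inl x)) (CMethod.rem (Sum.inl y)) }

/-- The stack sequential specification `S_S` (pool axioms plus stack order). -/
def stackSpec (V : Type u) (E : Type v) : Set (List (CMethod V E)) :=
  { s | s ∈ poolSpec V E ∧
    ∀ x y : V, OccursBefore s (CMethod.ins x) (CMethod.ins y) →
      OccursBefore s (CMethod.ins y) (CMethod.rem (Sum.inl x)) →
      CMethod.rem (Sum.inl y) ∈ s ∧
      OccursBefore s (CMethod.rem (Sum.inl y)) (CMethod.rem (Sum.inl x)) }

/-- A method call's value lies in `V' ∪ Emp`. -/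
def ProjKeep (V' : Set V) : CMethod V E → Prop
  | .ins x => x ∈ V'
  | .rem (Sum.inl x) => x ∈ V'
  | .rem (Sum.inr _) => True

open Classical in
/-- The data-projection of a sequence: the subsequence of method calls whose
value lies in `V' ∪ Emp`. -/
noncomputable def dataProj (V' : Set V) (s : List (CMethod V E)) :
    List (CMethod V E) :=
  s.filter fun m => decide (ProjKeep V' m)

/-- `S` is closed under data-projection. -/
def ClosedUnderDataProjection (S : Set (List (CMethod V E))) : Prop :=
  ∀ s ∈ S, ∀ V' : Set V, dataProj V' s ∈ S

end LL

namespace LL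

variable {I : Type*} {V : Type*} {E : Type*}

section MultiObject

variable {O : Type*} {Sg : O → Type*}

open Classical in
/-- The projection `h|q` of a history over a set of objects to the object `q`:
the subsequence of events of object `q`, viewed as a history over `Sg q`. -/
noncomputable def objProj (h : List (Event ((q : O) × Sg q) I)) (q : O) :
    List (Event (Sg q) I) :=
  h.filterMap fun e =>
    match e with
    | .inv mm k => if hq : mm.1 = q then some (Event.inv (hq ▸ mm.2) k) else none
    | .res mm k => if hq : mm.1 = q then some (Event.res (hq ▸ mm.2) k) else none

open Classical in
/-- The projection `s|q` of a sequence of method calls over a set of objects to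
the method calls of object `q`. -/
noncomputable def seqProj (s : List ((q : O) × Sg q)) (q : O) : List (Sg q) :=
  s.filterMap fun mm => if hq : mm.1 = q then some (hq ▸ mm.2) else none

/-- Membership of a method call of a multi-object container history in
`I_T ∪ O_T`: insertions (on any object) performed by thread `T` in `h`,
removals of values inserted (on the same object) by `T` in `h`, and removals
returning an "empty" value. Here `kind q` classifies the method calls of the
container alphabet `Sg q` into insertions and removals. -/
def InducedMethodO (kind : ∀ q : O, Sg q → CMethod V E)
    (h : List (Event ((q : O) × Sg q) I)) (T : I) (mm : (q : O) × Sg q) : Prop :=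
  (∃ x : V, kind mm.1 mm.2 = CMethod.ins x ∧ Event.inv mm T ∈ h) ∨
  (∃ x : V, kind mm.1 mm.2 = CMethod.rem (Sum.inl x) ∧
    ∃ m' : Sg mm.1, kind mm.1 m' = CMethod.ins x ∧ Event.inv ⟨mm.1, m'⟩ T ∈ h) ∨
  (∃ e : E, kind mm.1 mm.2 = CMethod.rem (Sum.inr e))

open Classical in
/-- The thread-induced history `h_T` of a multi-object container history. -/
noncomputable def threadInducedO (kind : ∀ q : O, Sg q → CMethod V E)
    (h : List (Event ((q : O) × Sg q) I)) (T : I) :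
    List (Event ((q : O) × Sg q) I) :=
  h.filter fun e => decide (InducedMethodO kind h T e.method)

/-- A history over a set of objects `O` is linearizable wrt the sequential
specifications `S q`: some completion admits a precedence-preserving
permutation `s` of its method calls such that `s|q ∈ S q` for every `q`. -/
def LinearizableO (S : ∀ q : O, Set (List (Sg q)))
    (h : List (Event ((q : O) × Sg q) I)) : Prop :=
  ∃ hc : List (Event ((q : O) × Sg q) I), IsCompletionOf hc h ∧
    ∃ s : List ((q : O) × Sg q), s.Perm (methodList hc) ∧
      (∀ m n : (q : O) × Sg q, Precedes hc m n → OccursBefore s m n) ∧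
      ∀ q : O, seqProj s q ∈ S q

/-- A history over a set of objects `O` is locally linearizable wrt the
sequential specifications `S q`: every thread-induced history is linearizable
over `O`, and the thread-induced histories decompose `h`. -/
def LocallyLinearizableO (kind : ∀ q : O, Sg q → CMethod V E)
    (S : ∀ q : O, Set (List (Sg q)))
    (h : List (Event ((q : O) × Sg q) I)) : Prop :=
  (∀ T : I, LinearizableO S (threadInducedO kind h T)) ∧
  (∀ mm : (q : O) × Sg q, Appears h mm → ∃ T : I, InducedMethodO kind h T mm)

end MultiObject

section SingleObject

variable {σ : Type*}

/-- Membership of a method call in `I_T ∪ O_T` for a single-object history over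
a container alphabet `σ` whose method calls are classified by `kind`. -/
def InducedMethodK (kind : σ → CMethod V E) (h : List (Event σ I)) (T : I)
    (m : σ) : Prop :=
  (∃ x : V, kind m = CMethod.ins x ∧ Event.inv m T ∈ h) ∨
  (∃ x : V, kind m = CMethod.rem (Sum.inl x) ∧
    ∃ m' : σ, kind m' = CMethod.ins x ∧ Event.inv m' T ∈ h) ∨
  (∃ e : E, kind m = CMethod.rem (Sum.inr e))

open Classical in
/-- The thread-induced history `h_T` for a single object. -/
noncomputable def threadInducedK (kind : σ → CMethod V E) (h : List (Event σ I))
    (T : I) : List (Event σ I) :=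
  h.filter fun e => decide (InducedMethodK kind h T e.method)

/-- Local linearizability of a single-object history over a container alphabet
`σ` classified by `kind`, wrt a sequential specification `S`. -/
def LocallyLinearizableK (kind : σ → CMethod V E) (S : Set (List σ))
    (h : List (Event σ I)) : Prop :=
  (∀ T : I, Linearizable S (threadInducedK kind h T)) ∧
  (∀ m : σ, Appears h m → ∃ T : I, InducedMethodK kind h T m)

end SingleObject

section PairSublist

variable {α : Type*} {l l' : List α} {a b c : α}

theorem occursBefore_iff_sublist : OccursBefore l a b ↔ [a, b].Sublist l := by
  constructor
  · rintro ⟨i, j, hij, rfl, rfl⟩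
    refine List.sublist_iff_exists_fin_orderEmbedding_get_eq.2
      ⟨OrderEmbedding.ofStrictMono ![i, j] ?_, ?_⟩
    · intro x y hxy
      fin_cases x <;> fin_cases y <;> simp_all
    · intro x
      fin_cases x <;> rfl
  · intro h
    obtain ⟨f, hf⟩ := List.sublist_iff_exists_fin_orderEmbedding_get_eq.1 h
    exact ⟨f ⟨0, by simp⟩, f ⟨1, by simp⟩, f.strictMono (by simp), (hf _).symm, (hf _).symm⟩

theorem mem_left_of_pair_sublist (h : [a, b].Sublist l) : a ∈ l :=
  h.subset (by simp)

theorem mem_right_of_pair_sublist (h : [a, b].Sublist l) : b ∈ l :=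
  h.subset (by simp)

theorem ne_of_pair_sublist (hl : l.Nodup) (h : [a, b].Sublist l) : a ≠ b := by
  simpa using hl.sublist h

theorem pair_sublist_or (ha : a ∈ l) (hb : b ∈ l) (hab : a ≠ b) :
    [a, b].Sublist l ∨ [b, a].Sublist l := by
  obtain ⟨i, rfl⟩ := List.get_of_mem ha
  obtain ⟨j, rfl⟩ := List.get_of_mem hb
  rcases lt_trichotomy i j with h | h | h
  · exact .inl (occursBefore_iff_sublist.1 ⟨i, j, h, rfl, rfl⟩)
  · exact absurd (congrArg l.get h) hab
  · exact .inr (occursBefore_iff_sublist.1 ⟨j, i, h, rfl, rfl⟩)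

theorem pair_sublist_trans (hl : l.Nodup) (h₁ : [a, b].Sublist l) (h₂ : [b, c].Sublist l) :
    [a, c].Sublist l := by
  rw [← occursBefore_iff_sublist] at *
  obtain ⟨i, j, hij, rfl, rfl⟩ := h₁
  obtain ⟨j', k, hjk, hj, rfl⟩ := h₂
  obtain rfl := hl.injective_get hj
  exact ⟨i, k, hij.trans hjk, rfl, rfl⟩

theorem not_pair_sublist_swap (hl : l.Nodup) (h₁ : [a, b].Sublist l) : ¬ [b, a].Sublist l :=
  fun h₂ => ne_of_pair_sublist hl (pair_sublist_trans hl h₁ h₂) rfl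

theorem pair_sublist_of_mem (hl : l.Nodup) (hs : l'.Sublist l) (h : [a, b].Sublist l)
    (ha : a ∈ l') (hb : b ∈ l') : [a, b].Sublist l' :=
  (pair_sublist_or ha hb (ne_of_pair_sublist hl h)).resolve_right
    fun h' => not_pair_sublist_swap hl h (h'.trans hs)

theorem pair_sublist_filter {p : α → Bool} (h : [a, b].Sublist l) (ha : p a) (hb : p b) :
    [a, b].Sublist (l.filter p) := by
  simpa [ha, hb] using h.filter p

theorem pair_sublist_map {β : Type*} {f : α → β} (hf : Function.Injective f) :
    [f a, f b].Sublist (l.map f) ↔ [a, b].Sublist l := by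
  refine ⟨fun h => ?_, fun h => h.map f⟩
  obtain ⟨l₁, hl₁, h⟩ := List.sublist_map_iff.1 h
  obtain rfl : [a, b] = l₁ := List.map_injective_iff.2 hf h
  exact hl₁

theorem pair_sublist_append_left (h : [a, b].Sublist (l ++ l')) (hb : b ∉ l') :
    [a, b].Sublist l := by
  obtain ⟨l₁, l₂, h, h₁, h₂⟩ := List.sublist_append_iff.1 h
  rcases List.eq_nil_or_concat l₂ with rfl | ⟨t, x, rfl⟩
  · simpa [h] using h₁
  · have : b = x := by
      have := congrArg List.getLast? h
      simpa [← List.append_assoc] using this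
    exact absurd (h₂.subset (by simp [this])) hb

theorem pair_sublist_append_of_mem (ha : a ∈ l) (hb : b ∈ l') : [a, b].Sublist (l ++ l') :=
  (List.singleton_sublist.2 ha).append (List.singleton_sublist.2 hb)

theorem pair_sublist_iff_idxOf [DecidableEq α] (hl : l.Nodup) (ha : a ∈ l) (hb : b ∈ l) :
    [a, b].Sublist l ↔ l.idxOf a < l.idxOf b := by
  rw [← occursBefore_iff_sublist]
  constructor
  · rintro ⟨i, j, hij, rfl, rfl⟩
    simpa [hl.idxOf_getElem] using hij
  · intro h
    exact ⟨⟨_, List.idxOf_lt_length_iff.2 ha⟩, ⟨_, List.idxOf_lt_length_iff.2 hb⟩, h,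
      by simp, by simp⟩

end PairSublist

section History

variable {σ I : Type*} {h : List (Event σ I)} {m n : σ}

theorem precedes_iff : Precedes h m n ↔
    ∃ k k', [Event.res m k, Event.inv n k'].Sublist h := by
  simp only [← occursBefore_iff_sublist]
  constructor
  · rintro ⟨i, j, k, k', hij, hi, hj⟩
    exact ⟨k, k', i, j, hij, hi, hj⟩
  · rintro ⟨k, k', i, j, hij, hi, hj⟩
    exact ⟨i, j, k, k', hij, hi, hj⟩

/-- Well-formedness of a history, phrased through two-element subsequences. -/
theorem isHistory_iff : IsHistory h ↔ h.Nodup ∧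
    (∀ m k k', Event.inv m k ∈ h → Event.inv m k' ∈ h → k = k') ∧
    (∀ m k, Event.res m k ∈ h → [Event.inv m k, Event.res m k].Sublist h) ∧
    (∀ m e, [Event.inv m e.thread, e].Sublist h →
      e = Event.res m e.thread ∨ [Event.res m e.thread, e].Sublist h) := by
  classical
  constructor
  · intro hh
    refine ⟨hh.nodup, ?_, ?_, ?_⟩
    · intro m k k' hk hk'
      obtain ⟨i, hi⟩ := List.get_of_mem hk
      obtain ⟨j, hj⟩ := List.get_of_mem hk'
      obtain rfl := hh.invUnique i j m k k' hi hj
      simpa using hi.symm.trans hj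
    · intro m k hk
      obtain ⟨j, hj⟩ := List.get_of_mem hk
      obtain ⟨i, hij, hi⟩ := hh.resMatched j m k hj
      exact occursBefore_iff_sublist.1 ⟨i, j, hij, hi, hj⟩
    · intro m e he
      have hs : [Event.inv m e.thread, e].Sublist (threadEvents h e.thread) :=
        pair_sublist_filter he (by simp [Event.thread]) (by simp)
      obtain ⟨i, j, hij, hi, hj⟩ := occursBefore_iff_sublist.2 hs
      have hi1 : (i : ℕ) + 1 < (threadEvents h e.thread).length := by omega
      have := hh.threadSeq e.thread i m (by rw [List.getElem?_eq_getElem i.2]; exact congrArg _ hi)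
        _ (List.getElem?_eq_getElem hi1)
      rcases eq_or_lt_of_le (show (i : ℕ) + 1 ≤ j from hij) with h1 | h1
      · left
        exact (hj.symm.trans (by simp [h1])).trans this
      · right
        exact (occursBefore_iff_sublist.1 ⟨⟨_, hi1⟩, j, h1, this, hj⟩).trans List.filter_sublist
  · rintro ⟨hnd, huniq, hres, hseq⟩
    refine ⟨hnd, ?_, ?_, ?_⟩
    · intro i j m k k' hi hj
      obtain rfl := huniq m k k' (hi ▸ List.get_mem h i) (hj ▸ List.get_mem h j)
      exact hnd.injective_get (hi.trans hj.symm)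
    · intro j m k hj
      obtain ⟨i, j', hij, hi, hj'⟩ := occursBefore_iff_sublist.2
        (hres m k (hj ▸ List.get_mem h j))
      obtain rfl := hnd.injective_get (hj'.trans hj.symm)
      exact ⟨i, hij, hi⟩
    · intro k i m hi e he
      have hnd' : (threadEvents h k).Nodup := hnd.sublist List.filter_sublist
      have hek : e.thread = k := by
        simpa using (List.mem_filter.1 (List.mem_of_getElem? he)).2
      subst hek
      obtain ⟨hi1, hi⟩ := List.getElem?_eq_some_iff.1 hi
      obtain ⟨he1, he⟩ := List.getElem?_eq_some_iff.1 he
      have hie : [Event.inv m e.thread, e].Sublist (threadEvents h e.thread) :=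
        occursBefore_iff_sublist.1 ⟨⟨i, hi1⟩, ⟨i + 1, he1⟩, by simp, hi, he⟩
      refine (hseq m e (hie.trans List.filter_sublist)).resolve_right fun hre => ?_
      have h1 : [Event.res m e.thread, e].Sublist (threadEvents h e.thread) :=
        pair_sublist_filter hre (by simp [Event.thread]) (by simp)
      have h2 : [Event.inv m e.thread, Event.res m e.thread].Sublist (threadEvents h e.thread) :=
        pair_sublist_filter (hres _ _ (mem_left_of_pair_sublist hre)) (by simp [Event.thread])
          (by simp [Event.thread])
      rw [pair_sublist_iff_idxOf hnd' (mem_left_of_pair_sublist h1)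
        (mem_right_of_pair_sublist h1)] at h1
      rw [pair_sublist_iff_idxOf hnd' (mem_left_of_pair_sublist h2)
        (mem_right_of_pair_sublist h2)] at h2
      have h3 := hnd'.idxOf_getElem i hi1
      have h4 := hnd'.idxOf_getElem (i + 1) he1
      rw [hi] at h3
      rw [he] at h4
      omega

theorem mem_methodList : m ∈ methodList h ↔ Appears h m := by
  constructor
  · intro hm
    obtain ⟨e, he, rfl⟩ := List.mem_map.1 hm
    obtain ⟨he, hi⟩ := List.mem_filter.1 he
    cases e with
    | inv m k => exact ⟨k, he⟩
    | res m k => simp [Event.isInv] at hi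
  · rintro ⟨k, hk⟩
    exact List.mem_map.2 ⟨_, List.mem_filter.2 ⟨hk, rfl⟩, rfl⟩

theorem sublist_of_methodList_sublist (hs : [m, n].Sublist (methodList h)) :
    ∃ k k', [Event.inv m k, Event.inv n k'].Sublist h := by
  obtain ⟨l, hl, hmn⟩ := List.sublist_map_iff.1 hs
  obtain ⟨e, l, rfl, he, hmn⟩ := List.map_eq_cons_iff.1 hmn.symm
  obtain ⟨e', l, rfl, he', hmn⟩ := List.map_eq_cons_iff.1 hmn
  obtain rfl := List.map_eq_nil_iff.1 hmn
  have h1 := (List.mem_filter.1 (mem_left_of_pair_sublist hl)).2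
  have h2 := (List.mem_filter.1 (mem_right_of_pair_sublist hl)).2
  have h3 := hl.trans List.filter_sublist
  cases e <;> cases e' <;> simp_all [Event.isInv, Event.method]
  exact ⟨_, _, h3⟩

theorem IsHistory.thread_unique (hh : IsHistory h) {k k' : I} (hk : Event.inv m k ∈ h)
    (hk' : Event.inv m k' ∈ h) : k = k' :=
  (isHistory_iff.1 hh).2.1 m k k' hk hk'

theorem IsHistory.nodup_methodList (hh : IsHistory h) : (methodList h).Nodup := by
  refine List.Nodup.map_on ?_ (hh.nodup.sublist List.filter_sublist)
  intro e he e' he' hee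
  obtain ⟨he, hi⟩ := List.mem_filter.1 he
  obtain ⟨he', hi'⟩ := List.mem_filter.1 he'
  cases e <;> cases e' <;> simp_all [Event.isInv, Event.method]
  exact hh.thread_unique he he'

theorem IsHistory.precedes_of_sublist_methodList (hh : IsHistory h) {m' : σ}
    (hp : Precedes h m n) (hs : [n, m'].Sublist (methodList h)) : Precedes h m m' := by
  obtain ⟨k, k', hk⟩ := precedes_iff.1 hp
  obtain ⟨k₁, k₂, hk'⟩ := sublist_of_methodList_sublist hs
  obtain rfl := hh.thread_unique (mem_right_of_pair_sublist hk) (mem_left_of_pair_sublist hk')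
  exact precedes_iff.2 ⟨k, k₂, pair_sublist_trans hh.nodup hk hk'⟩

/-- Keeping all events of a set of method calls turns a history into a history. -/
theorem IsHistory.filter_method (hh : IsHistory h) (p : σ → Bool) :
    IsHistory (h.filter fun e => p e.method) := by
  obtain ⟨hnd, huniq, hres, hseq⟩ := isHistory_iff.1 hh
  refine isHistory_iff.2 ⟨hnd.sublist List.filter_sublist, ?_, ?_, ?_⟩
  · exact fun m k k' hk hk' => huniq m k k' (List.mem_filter.1 hk).1 (List.mem_filter.1 hk').1
  · intro m k hk
    obtain ⟨hk, hp⟩ := List.mem_filter.1 hk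
    exact pair_sublist_filter (hres m k hk) hp hp
  · intro m e he
    have hm := (List.mem_filter.1 (mem_left_of_pair_sublist he)).2
    have he' := (List.mem_filter.1 (mem_right_of_pair_sublist he)).2
    exact (hseq m e (he.trans List.filter_sublist)).imp id
      fun h' => pair_sublist_filter h' hm he'

open Classical in
/-- Every history becomes complete by appending responses for its pending invocations. -/
theorem IsHistory.exists_complete (hh : IsHistory h) : ∃ r : List (Event σ I),
    (∀ e ∈ r, ∃ m k, e = Event.res m k ∧ PendingCall h m k) ∧
    IsHistory (h ++ r) ∧ HistComplete (h ++ r) := by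
  let r : List (Event σ I) :=
    (h.filter fun e => decide (e.isInv ∧ Event.res e.method e.thread ∉ h)).map
      fun e => Event.res e.method e.thread
  have hr : ∀ e, e ∈ r ↔ ∃ m k, e = Event.res m k ∧ PendingCall h m k := by
    intro e
    constructor
    · intro he
      obtain ⟨e', he', rfl⟩ := List.mem_map.1 he
      obtain ⟨hmem, hp⟩ := List.mem_filter.1 he'
      cases e' with
      | inv m k => exact ⟨m, k, rfl, hmem, (of_decide_eq_true hp).2⟩
      | res m k => simp [Event.isInv] at hp
    · rintro ⟨m, k, rfl, hi, hp⟩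
      exact List.mem_map.2 ⟨_, List.mem_filter.2 ⟨hi, decide_eq_true ⟨rfl, hp⟩⟩, rfl⟩
  have hinv : ∀ {m k}, Event.inv m k ∈ h ++ r → Event.inv m k ∈ h := by
    intro m k hk
    refine (List.mem_append.1 hk).resolve_right fun hk => ?_
    obtain ⟨_, _, h', -⟩ := (hr _).1 hk
    cases h'
  obtain ⟨hnd, huniq, hres, hseq⟩ := isHistory_iff.1 hh
  refine ⟨r, fun e => (hr e).1, isHistory_iff.2 ⟨?_, ?_, ?_, ?_⟩, ?_⟩
  · refine List.nodup_append'.2 ⟨hnd, ?_, ?_⟩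
    · refine List.Nodup.map_on ?_ (hnd.sublist List.filter_sublist)
      intro e he e' he' hee
      have h1 := (List.mem_filter.1 he).2
      have h2 := (List.mem_filter.1 he').2
      cases e <;> cases e' <;> simp_all [Event.isInv, Event.method, Event.thread]
    · intro e he he'
      obtain ⟨m, k, rfl, hp⟩ := (hr e).1 he'
      exact hp.2 he
  · exact fun m k k' hk hk' => huniq m k k' (hinv hk) (hinv hk')
  · intro m k hk
    rcases List.mem_append.1 hk with hk | hk
    · exact (hres m k hk).trans (List.sublist_append_left _ _)
    · obtain ⟨_, _, heq, hp⟩ := (hr _).1 hk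
      cases heq
      exact pair_sublist_append_of_mem hp.1 hk
  · intro m e he
    by_cases her : e ∈ r
    · have hm := hinv (mem_left_of_pair_sublist he)
      obtain ⟨m', k, rfl, hp⟩ := (hr e).1 her
      by_cases hmm : m = m'
      · exact .inl (by rw [hmm]; rfl)
      · rcases pair_sublist_or hm hp.1 (by simp [hmm]) with h' | h'
        · rcases hseq m (Event.inv m' k) h' with h' | h'
          · cases h'
          · exact .inr (pair_sublist_append_of_mem (mem_left_of_pair_sublist h') her)
        · rcases hseq m' (Event.inv m k) h' with h' | h'
          · cases h'
          · exact absurd (mem_left_of_pair_sublist h') hp.2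
    · exact (hseq m e (pair_sublist_append_left he her)).imp id
        fun h' => h'.trans (List.sublist_append_left _ _)
  · intro m k hk
    by_cases hp : Event.res m k ∈ h
    · exact List.mem_append_left _ hp
    · exact List.mem_append_right _ ((hr _).2 ⟨m, k, rfl, hinv hk, hp⟩)

theorem IsCompletionOf.inv_mem {hc : List (Event σ I)} (hcomp : IsCompletionOf hc h) {k : I}
    (hk : Event.inv m k ∈ hc) : Event.inv m k ∈ h := by
  obtain ⟨-, -, h', r, hs, -, hr, rfl⟩ := hcomp
  refine hs.subset ((List.mem_append.1 hk).resolve_right fun hk => ?_)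
  obtain ⟨_, _, heq, -⟩ := hr _ hk
  cases heq

theorem IsCompletionOf.appears_of_res_mem {hc : List (Event σ I)} (hcomp : IsCompletionOf hc h)
    {k : I} (hk : Event.res m k ∈ h) : Appears hc m := by
  obtain ⟨hh, -, h', r, -, hdel, -, rfl⟩ := hcomp
  have hk' : Event.res m k ∈ h' ++ r := by
    refine List.mem_append_left _ (by_contra fun h' => ?_)
    obtain ⟨_, _, heq, -⟩ := hdel _ hk h'
    cases heq
  exact ⟨k, mem_left_of_pair_sublist ((isHistory_iff.1 hh).2.2.1 m k hk')⟩

theorem IsCompletionOf.precedes_iff {hc : List (Event σ I)} (hcomp : IsCompletionOf hc h)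
    (hh : IsHistory h) : Precedes hc m n ↔ Precedes h m n ∧ Appears hc n := by
  have hinv := @IsCompletionOf.inv_mem _ _ _ n _ hcomp
  obtain ⟨-, -, h', r, hs, hdel, hr, rfl⟩ := hcomp
  have hnr : ∀ k, Event.inv n k ∉ r := by
    intro k hk
    obtain ⟨_, _, heq, -⟩ := hr _ hk
    cases heq
  rw [LL.precedes_iff, LL.precedes_iff]
  constructor
  · rintro ⟨k, k', hp⟩
    exact ⟨⟨k, k', (pair_sublist_append_left hp (hnr k')).trans hs⟩, k',
      mem_right_of_pair_sublist hp⟩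
  · rintro ⟨⟨k, k', hp⟩, k₁, hk₁⟩
    obtain rfl := hh.thread_unique (hinv hk₁) (mem_right_of_pair_sublist hp)
    refine ⟨k, k₁, (pair_sublist_of_mem hh.nodup hs hp (by_contra fun hn => ?_)
      ((List.mem_append.1 hk₁).resolve_right (hnr _))).trans (List.sublist_append_left _ _)⟩
    obtain ⟨_, _, heq, -⟩ := hdel _ (mem_left_of_pair_sublist hp) hn
    cases heq

open Classical in
/-- A history has a completion that keeps any prescribed set of method calls containing all
those that have returned. -/
theorem IsHistory.exists_completion (hh : IsHistory h) (K : σ → Prop)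
    (hK : ∀ m k, Event.res m k ∈ h → K m) :
    ∃ hc, IsCompletionOf hc h ∧ ∀ m, Appears hc m ↔ Appears h m ∧ K m := by
  have hh' := hh.filter_method fun m => decide (K m)
  obtain ⟨r, hr, hist, hcpl⟩ := hh'.exists_complete
  refine ⟨_, ⟨hist, hcpl, _, r, List.filter_sublist, ?_, ?_, rfl⟩, ?_⟩
  · intro e he hne
    have hne : ¬ K e.method := by simpa [he] using hne
    cases e with
    | inv m k => exact ⟨m, k, rfl, he, fun hk => hne (hK m k hk)⟩
    | res m k => exact absurd (hK m k he) hne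
  · intro e he
    obtain ⟨m, k, rfl, hi, hp⟩ := hr e he
    obtain ⟨hi, hm⟩ := List.mem_filter.1 hi
    exact ⟨m, k, rfl, hi, fun hk => hp (List.mem_filter.2 ⟨hk, hm⟩)⟩
  · intro m
    constructor
    · rintro ⟨k, hk⟩
      rcases List.mem_append.1 hk with hk | hk
      · obtain ⟨hk, hm⟩ := List.mem_filter.1 hk
        exact ⟨⟨k, hk⟩, of_decide_eq_true hm⟩
      · obtain ⟨_, _, heq, -⟩ := hr _ hk
        cases heq
    · rintro ⟨⟨k, hk⟩, hm⟩
      exact ⟨k, List.mem_append_left _ (List.mem_filter.2 ⟨hk, decide_eq_true hm⟩)⟩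

end History

section Projection

variable {I O : Type*} {Sg : O → Type*} {q : O}

/-- An event of object `q`, viewed as an event of the multi-object alphabet. -/
def Event.lift (q : O) : Event (Sg q) I → Event ((q : O) × Sg q) I
  | .inv m k => .inv ⟨q, m⟩ k
  | .res m k => .res ⟨q, m⟩ k

theorem Event.lift_injective : Function.Injective (Event.lift (Sg := Sg) (I := I) q) := by
  rintro (_ | _) (_ | _) h <;> simp_all [Event.lift]

theorem Event.thread_lift (e : Event (Sg q) I) : (e.lift q).thread = e.thread := by
  cases e <;> rfl

open Classical in
theorem map_lift_objProj (h : List (Event ((q : O) × Sg q) I)) (q : O) :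
    (objProj h q).map (Event.lift q) = h.filter fun e => decide (e.method.1 = q) := by
  induction h with
  | nil => rfl
  | cons e h ih =>
    unfold objProj at ih ⊢
    rcases e with ⟨⟨q', m⟩, k⟩ | ⟨⟨q', m⟩, k⟩ <;> by_cases hq : q' = q
    all_goals first
      | subst hq; simp [Event.method, Event.lift, ih]
      | simp [hq, Event.method, ih]

open Classical in
theorem map_mk_seqProj (s : List ((q : O) × Sg q)) (q : O) :
    (seqProj s q).map (Sigma.mk q) = s.filter fun m => decide (m.1 = q) := by
  induction s with
  | nil => rfl
  | cons m s ih =>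
    unfold seqProj at ih ⊢
    obtain ⟨q', m⟩ := m
    by_cases hq : q' = q
    · subst hq; simp [ih]
    · simp [hq, ih]

variable {h : List (Event ((q : O) × Sg q) I)} {s : List ((q : O) × Sg q)}

theorem mem_objProj {e : Event (Sg q) I} : e ∈ objProj h q ↔ e.lift q ∈ h := by
  rw [← List.mem_map_of_injective Event.lift_injective, map_lift_objProj]
  cases e <;> simp [Event.lift, Event.method]

theorem pair_sublist_objProj {e e' : Event (Sg q) I} :
    [e, e'].Sublist (objProj h q) ↔ [e.lift q, e'.lift q].Sublist h := by
  rw [← pair_sublist_map (Event.lift_injective (q := q)), map_lift_objProj]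
  refine ⟨fun hs => hs.trans List.filter_sublist, fun hs => pair_sublist_filter hs ?_ ?_⟩
  · cases e <;> simp [Event.lift, Event.method]
  · cases e' <;> simp [Event.lift, Event.method]

theorem nodup_objProj (hh : h.Nodup) : (objProj h q).Nodup :=
  List.Nodup.of_map (Event.lift q) (map_lift_objProj h q ▸ hh.sublist List.filter_sublist)

theorem mem_seqProj {m : Sg q} : m ∈ seqProj s q ↔ ⟨q, m⟩ ∈ s := by
  rw [← List.mem_map_of_injective (sigma_mk_injective (i := q)), map_mk_seqProj]
  simp

theorem pair_sublist_seqProj {m n : Sg q} :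
    [m, n].Sublist (seqProj s q) ↔ [(⟨q, m⟩ : (q : O) × Sg q), ⟨q, n⟩].Sublist s := by
  rw [← pair_sublist_map (sigma_mk_injective (i := q)), map_mk_seqProj]
  exact ⟨fun hs => hs.trans List.filter_sublist,
    fun hs => pair_sublist_filter hs (by simp) (by simp)⟩

theorem nodup_seqProj (hs : s.Nodup) : (seqProj s q).Nodup :=
  List.Nodup.of_map (Sigma.mk q) (map_mk_seqProj s q ▸ hs.sublist List.filter_sublist)

theorem IsHistory.objProj (hh : IsHistory h) (q : O) : IsHistory (objProj h q) := by
  obtain ⟨hnd, huniq, hres, hseq⟩ := isHistory_iff.1 hh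
  refine isHistory_iff.2 ⟨nodup_objProj hnd, ?_, ?_, ?_⟩
  · exact fun m k k' hk hk' => huniq ⟨q, m⟩ k k' (mem_objProj.1 hk) (mem_objProj.1 hk')
  · exact fun m k hk => pair_sublist_objProj.2 (hres ⟨q, m⟩ k (mem_objProj.1 hk))
  · intro m e he
    have := hseq ⟨q, m⟩ (e.lift q) (by
      rw [Event.thread_lift]
      exact pair_sublist_objProj.1 he)
    rw [Event.thread_lift] at this
    exact this.imp (fun h' => Event.lift_injective h') pair_sublist_objProj.2

theorem appears_objProj {m : Sg q} : Appears (objProj h q) m ↔ Appears h ⟨q, m⟩ :=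
  exists_congr fun _ => mem_objProj

theorem precedes_objProj {m n : Sg q} :
    Precedes (objProj h q) m n ↔ Precedes h ⟨q, m⟩ ⟨q, n⟩ := by
  simp only [precedes_iff, pair_sublist_objProj, Event.lift]

theorem pendingCall_objProj {m : Sg q} {k : I} :
    PendingCall (objProj h q) m k ↔ PendingCall h ⟨q, m⟩ k :=
  and_congr mem_objProj (not_congr mem_objProj)

theorem Event.lift_eq_inv {e : Event (Sg q) I} {m : (q : O) × Sg q} {k : I} :
    e.lift q = .inv m k ↔ ∃ m', m = ⟨q, m'⟩ ∧ e = .inv m' k := by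
  cases e <;> simp [Event.lift, eq_comm]

theorem Event.lift_eq_res {e : Event (Sg q) I} {m : (q : O) × Sg q} {k : I} :
    e.lift q = .res m k ↔ ∃ m', m = ⟨q, m'⟩ ∧ e = .res m' k := by
  cases e <;> simp [Event.lift, eq_comm]

theorem IsCompletionOf.objProj {hc : List (Event ((q : O) × Sg q) I)} (hcomp : IsCompletionOf hc h)
    (q : O) : IsCompletionOf (objProj hc q) (objProj h q) := by
  obtain ⟨hh, hcpl, h', r, hs, hdel, hr, rfl⟩ := hcomp
  refine ⟨hh.objProj q, fun m k hk => mem_objProj.2 (hcpl _ _ (mem_objProj.1 hk)),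
    LL.objProj h' q, LL.objProj r q, hs.filterMap _, ?_, ?_, List.filterMap_append⟩
  · intro e he he'
    obtain ⟨m, k, hmk, hp⟩ := hdel _ (mem_objProj.1 he) (fun h'' => he' (mem_objProj.2 h''))
    obtain ⟨m', rfl, rfl⟩ := Event.lift_eq_inv.1 hmk
    exact ⟨m', k, rfl, pendingCall_objProj.2 hp⟩
  · intro e he
    obtain ⟨m, k, hmk, hp⟩ := hr _ (mem_objProj.1 he)
    obtain ⟨m', rfl, rfl⟩ := Event.lift_eq_res.1 hmk
    exact ⟨m', k, rfl, pendingCall_objProj.2 hp⟩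

theorem perm_methodList_objProj (hh : IsHistory h) (q : O) :
    (seqProj (methodList h) q).Perm (methodList (objProj h q)) := by
  rw [List.perm_ext_iff_of_nodup (nodup_seqProj hh.nodup_methodList)
    (hh.objProj q).nodup_methodList]
  intro m
  rw [mem_seqProj, mem_methodList, mem_methodList, appears_objProj]

/-- Linearizability over a set of objects passes to each object. -/
theorem LinearizableO.objProj {S : ∀ q : O, Set (List (Sg q))} (hlin : LinearizableO S h) (q : O) :
    Linearizable (S q) (objProj h q) := by
  obtain ⟨hc, hcomp, s, hperm, hprec, hS⟩ := hlin
  refine ⟨LL.objProj hc q, hcomp.objProj q, seqProj s q, hS q,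
    (hperm.filterMap _).trans (perm_methodList_objProj hcomp.1 q), fun m n hmn => ?_⟩
  rw [occursBefore_iff_sublist, pair_sublist_seqProj, ← occursBefore_iff_sublist]
  exact hprec _ _ (precedes_objProj.1 hmn)

/-- Per-object total orders compatible with an interval order `P` merge into one total order
compatible with `P`. A method call is sorted by the latest position in `L` of the calls that its
object orders no later than it. -/
theorem exists_merge (L : List ((q : O) × Sg q)) (hL : L.Nodup)
    (P : (q : O) × Sg q → (q : O) × Sg q → Prop)
    (hPL : ∀ m n, P m n → m ∈ L ∧ n ∈ L)
    (hP : ∀ m n n', P m n → [n, n'].Sublist L → P m n')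
    (s : ∀ q, List (Sg q)) (hs : ∀ q, (s q).Perm (seqProj L q))
    (hsP : ∀ q m n, P ⟨q, m⟩ ⟨q, n⟩ → [m, n].Sublist (s q)) :
    ∃ t : List ((q : O) × Sg q), t.Perm L ∧ (∀ m n, P m n → [m, n].Sublist t) ∧
      ∀ q, seqProj t q = s q := by
  classical
  have hsnd : ∀ q, (s q).Nodup := fun q => (hs q).nodup_iff.2 (nodup_seqProj hL)
  have hmem : ∀ q m, m ∈ s q ↔ (⟨q, m⟩ : (q : O) × Sg q) ∈ L := fun q m =>
    (hs q).mem_iff.trans mem_seqProj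
  let idx : (q : O) × Sg q → ℕ := fun m => (s m.1).idxOf m.2
  let before : (m : (q : O) × Sg q) → Finset (Sg m.1) := fun m =>
    (s m.1).toFinset.filter fun x => (s m.1).idxOf x ≤ idx m
  let pt : (q : O) × Sg q → ℕ := fun m => (before m).sup fun x => L.idxOf ⟨m.1, x⟩
  let key : (q : O) × Sg q → ℕ ×ₗ ℕ := fun m => toLex (pt m, idx m)
  have hself : ∀ m ∈ L, m.2 ∈ before m := fun m hm =>
    Finset.mem_filter.2 ⟨List.mem_toFinset.2 ((hmem _ _).2 hm), le_rfl⟩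
  have hkeyP : ∀ m n, P m n → key m < key n := by
    intro m n hmn
    obtain ⟨hm, hn⟩ := hPL m n hmn
    refine Prod.Lex.toLex_lt_toLex.2 (.inl ?_)
    obtain ⟨x, hx, hpt⟩ := Finset.exists_mem_eq_sup (before m) ⟨_, hself m hm⟩
      fun x => L.idxOf (⟨m.1, x⟩ : (q : O) × Sg q)
    have hle : L.idxOf n ≤ pt n :=
      Finset.le_sup (f := fun x => L.idxOf (⟨n.1, x⟩ : (q : O) × Sg q)) (hself n hn)
    refine lt_of_lt_of_le ?_ hle
    change (before m).sup _ < _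
    rw [hpt]
    obtain ⟨hxs, hxm⟩ := Finset.mem_filter.1 hx
    have hxs := List.mem_toFinset.1 hxs
    have hxL := (hmem _ _).1 hxs
    by_contra! hlt
    have hPx : P m ⟨m.1, x⟩ := by
      rcases eq_or_lt_of_le hlt with heq | hlt
      · rwa [← (List.idxOf_inj hn).1 heq]
      · exact hP _ _ _ hmn ((pair_sublist_iff_idxOf hL hn hxL).2 hlt)
    exact absurd ((pair_sublist_iff_idxOf (hsnd _) ((hmem _ _).2 hm) hxs).1 (hsP _ _ _ hPx))
      (not_lt.2 hxm)
  have hkeyidx : ∀ q (m n : Sg q), key ⟨q, m⟩ ≤ key ⟨q, n⟩ →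
      (s q).idxOf m ≤ (s q).idxOf n := by
    intro q m n hk
    by_contra! hlt
    refine absurd hk (not_le.2 (Prod.Lex.toLex_lt_toLex.2 ?_))
    have hpt : pt ⟨q, n⟩ ≤ pt ⟨q, m⟩ :=
      Finset.sup_mono fun x hx => Finset.mem_filter.2
        ⟨(Finset.mem_filter.1 hx).1, (Finset.mem_filter.1 hx).2.trans hlt.le⟩
    exact (lt_or_eq_of_le hpt).imp id fun h => ⟨h, hlt⟩
  let t := L.mergeSort fun a b => decide (key a ≤ key b)
  have htL : t.Perm L := List.mergeSort_perm _ _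
  have hsorted : t.Pairwise fun a b => key a ≤ key b := by
    have := List.pairwise_mergeSort (le := fun a b => decide (key a ≤ key b))
      (fun a b c => by simpa using le_trans) (fun a b => by simpa using le_total _ _) L
    simpa using this
  rw [List.pairwise_iff_forall_sublist] at hsorted
  refine ⟨t, htL, fun m n hmn => ?_, fun q => ?_⟩
  · obtain ⟨hm, hn⟩ := hPL m n hmn
    have hlt := hkeyP m n hmn
    exact (pair_sublist_or (htL.mem_iff.2 hm) (htL.mem_iff.2 hn)
      fun h => hlt.ne (congrArg key h)).resolve_right fun h => not_le.2 hlt (hsorted h)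
  · refine List.Perm.eq_of_pairwise (le := fun a b => (s q).idxOf a ≤ (s q).idxOf b) ?_ ?_ ?_
      ((htL.filterMap _).trans (hs q).symm)
    · exact fun a b _ hb h1 h2 => ((List.idxOf_inj hb).1 (le_antisymm h2 h1)).symm
    · exact List.pairwise_iff_forall_sublist.2 fun hab =>
        hkeyidx q _ _ (hsorted (pair_sublist_seqProj.1 hab))
    · exact List.pairwise_iff_forall_sublist.2 fun hab =>
        ((pair_sublist_iff_idxOf (hsnd q) (mem_left_of_pair_sublist hab)
          (mem_right_of_pair_sublist hab)).1 hab).le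

/-- Linearizability is compositional, non-trivial direction. -/
theorem IsHistory.linearizableO {S : ∀ q : O, Set (List (Sg q))} (hh : IsHistory h)
    (hlin : ∀ q, Linearizable (S q) (LL.objProj h q)) : LinearizableO S h := by
  choose hcq hcomp s hsS hperm hprec using hlin
  obtain ⟨hc, hccomp, hcapp⟩ := hh.exists_completion (fun m => Appears (hcq m.1) m.2)
    fun m k hk => (hcomp m.1).appears_of_res_mem (mem_objProj.2 hk)
  have happ : ∀ q (m : Sg q), Appears hc ⟨q, m⟩ ↔ Appears (hcq q) m := fun q m =>
    (hcapp ⟨q, m⟩).trans (and_iff_right_of_imp fun ⟨k, hk⟩ =>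
      ⟨k, mem_objProj.1 ((hcomp q).inv_mem hk)⟩)
  have hmem : ∀ m n, Precedes hc m n → m ∈ methodList hc ∧ n ∈ methodList hc := by
    intro m n hmn
    obtain ⟨k, k', hs⟩ := precedes_iff.1 hmn
    rw [mem_methodList, mem_methodList]
    exact ⟨⟨k, mem_left_of_pair_sublist
      ((isHistory_iff.1 hccomp.1).2.2.1 m k (mem_left_of_pair_sublist hs))⟩,
      k', mem_right_of_pair_sublist hs⟩
  have hsL : ∀ q, (s q).Perm (seqProj (methodList hc) q) := by
    intro q
    refine (hperm q).trans ?_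
    rw [List.perm_ext_iff_of_nodup (hcomp q).1.nodup_methodList
      (nodup_seqProj hccomp.1.nodup_methodList)]
    intro m
    rw [mem_seqProj, mem_methodList, mem_methodList, happ]
  have hsP : ∀ q m n, Precedes hc ⟨q, m⟩ ⟨q, n⟩ → [m, n].Sublist (s q) := by
    intro q m n hmn
    obtain ⟨hp, hn⟩ := (hccomp.precedes_iff hh).1 hmn
    exact occursBefore_iff_sublist.1 (hprec q m n (((hcomp q).precedes_iff (hh.objProj q)).2
      ⟨precedes_objProj.2 hp, (happ q n).1 hn⟩))
  obtain ⟨t, htL, htP, hts⟩ := exists_merge (methodList hc) hccomp.1.nodup_methodList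
    (Precedes hc) hmem (fun m n n' => hccomp.1.precedes_of_sublist_methodList) s hsL hsP
  exact ⟨hc, hccomp, t, htL, fun m n hmn => occursBefore_iff_sublist.2 (htP m n hmn),
    fun q => hts q ▸ hsS q⟩

variable {V E : Type*} {kind : ∀ q : O, Sg q → CMethod V E}

theorem inducedMethodK_objProj {T : I} {m : Sg q} :
    InducedMethodK (kind q) (objProj h q) T m ↔ InducedMethodO kind h T ⟨q, m⟩ := by
  simp only [InducedMethodK, InducedMethodO, mem_objProj, Event.lift]

theorem threadInducedK_objProj (T : I) :
    threadInducedK (kind q) (objProj h q) T = objProj (threadInducedO kind h T) q := by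
  apply List.map_injective_iff.2 (Event.lift_injective (q := q))
  rw [map_lift_objProj, threadInducedO, List.filter_comm, ← map_lift_objProj, List.filter_map,
    threadInducedK]
  congr 2
  funext e
  cases e <;> exact decide_eq_decide.2 inducedMethodK_objProj

end Projection

/-- Compositionality of local linearizability: a history `h` over a set of
objects `O`, each with container alphabet `Sg q` and sequential specification
`S q`, is locally linearizable over `O` iff for every object `q` the
projection `h|q` is locally linearizable wrt `S q`. -/
theorem locallyLinearizable_compositional
    (V E I O : Type*) (Sg : O → Type*) (kind : ∀ q : O, Sg q → CMethod V E)
    (S : ∀ q : O, Set (List (Sg q))) (hpc : ∀ q : O, PrefixClosed (S q))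
    (h : List (Event ((q : O) × Sg q) I)) (hh : IsHistory h) :
    LocallyLinearizableO kind S h ↔
      ∀ q : O, LocallyLinearizableK (kind q) (S q) (objProj h q) := by
  have hsub (T : I) : IsHistory (threadInducedO kind h T) :=
    hh.filter_method fun m => @decide (InducedMethodO kind h T m) (Classical.propDecidable _)
  constructor
  · rintro ⟨hlin, hdec⟩ q
    refine ⟨fun T => ?_, fun m hm => ?_⟩
    · rw [threadInducedK_objProj]
      exact (hlin T).objProj q
    · obtain ⟨T, hT⟩ := hdec ⟨q, m⟩ (appears_objProj.1 hm)
      exact ⟨T, inducedMethodK_objProj.2 hT⟩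
  · intro hloc
    refine ⟨fun T => (hsub T).linearizableO fun q => ?_, fun ⟨q, m⟩ hm => ?_⟩
    · rw [← threadInducedK_objProj]
      exact (hloc q).1 T
    · obtain ⟨T, hT⟩ := (hloc q).2 m (appears_objProj.2 hm)
      exact ⟨T, inducedMethodK_objProj.1 hT⟩

end LL
end

section
/- For stack, local linearizability is incomparable to quiescent consistency: (i) there exists a concurrent history over Σ_S that is quiescently consistent with respect to S_S but not locally linearizable with respect to S_S; and (ii) there exists a concurrent history over Σ_S that is locally linearizable with respect to S_S but not quiescently consistent with respect to S_S. -/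
namespace LL

theorem occursBefore_nil (a b : α) : ¬ OccursBefore ([] : List α) a b := by
  rintro ⟨i, -⟩
  exact i.elim0

theorem occursBefore_cons (c : α) (l : List α) (a b : α) :
    OccursBefore (c :: l) a b ↔ (c = a ∧ b ∈ l) ∨ OccursBefore l a b := by
  simp [OccursBefore, Fin.exists_fin_succ, List.mem_iff_get]

theorem OccursBefore.asymm {l : List α} (hl : l.Nodup) {a b : α}
    (hab : OccursBefore l a b) (hba : OccursBefore l b a) : False := by
  obtain ⟨i, j, hij, hi, hj⟩ := hab
  obtain ⟨i', j', hij', hi', hj'⟩ := hba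
  have h₁ : i = j' := hl.injective_get (hi.trans hj'.symm)
  have h₂ : j = i' := hl.injective_get (hj.trans hi'.symm)
  subst h₁ h₂
  exact lt_asymm hij hij'

theorem methodList_nil : methodList ([] : List (Event σ I)) = [] := rfl

theorem methodList_inv_cons (m : σ) (k : I) (h : List (Event σ I)) :
    methodList (Event.inv m k :: h) = m :: methodList h := rfl

theorem methodList_res_cons (m : σ) (k : I) (h : List (Event σ I)) :
    methodList (Event.res m k :: h) = methodList h := rfl

theorem precedes_iff_occursBefore (h : List (Event σ I)) (m n : σ) :
    Precedes h m n ↔ ∃ k k', OccursBefore h (Event.res m k) (Event.inv n k') := by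
  constructor
  · rintro ⟨i, j, k, k', H⟩
    exact ⟨k, k', i, j, H⟩
  · rintro ⟨k, k', i, j, H⟩
    exact ⟨i, j, k, k', H⟩

/-- A list-recursive criterion for being a concurrent history. -/
theorem IsHistory.of_nodup_isChain {h : List (Event σ I)} (hnd : h.Nodup)
    (hinv : (methodList h).Nodup)
    (hres : ∀ e ∈ h, ∀ m k, e = Event.res m k →
      OccursBefore h (Event.inv m k) (Event.res m k))
    (hthread : ∀ k, (threadEvents h k).IsChain
      fun e f => ∀ m, e = Event.inv m k → f = Event.res m k) :
    IsHistory h where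
  nodup := hnd
  invUnique i j m k k' hi hj := by
    rw [methodList, List.Nodup, List.pairwise_map, List.pairwise_filter,
      List.pairwise_iff_get] at hinv
    rcases lt_trichotomy i j with hij | hij | hij
    · exact (hinv i j hij (by rw [hi]; rfl) (by rw [hj]; rfl) (by rw [hi, hj]; rfl)).elim
    · exact hij
    · exact (hinv j i hij (by rw [hj]; rfl) (by rw [hi]; rfl) (by rw [hi, hj]; rfl)).elim
  resMatched j m k hj := by
    obtain ⟨i, j', hij, hi, hj'⟩ := hres _ (h.get_mem j) m k hj
    obtain rfl : j' = j := hnd.injective_get (hj'.trans hj.symm)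
    exact ⟨i, hij, hi⟩
  threadSeq k i m hi e he := by
    obtain ⟨hlt, he⟩ := List.getElem?_eq_some_iff.1 he
    obtain ⟨_, hi⟩ := List.getElem?_eq_some_iff.1 hi
    rw [← he]
    exact List.isChain_iff_getElem.1 (hthread k) i hlt m hi

theorem IsHistory.isCompletionOf_self {h : List (Event σ I)} (hh : IsHistory h)
    (hc : HistComplete h) : IsCompletionOf h h :=
  ⟨hh, hc, h, [], List.Sublist.refl h, fun _ he hne => (hne he).elim, by simp, by simp⟩

theorem IsCompletionOf.eq_of_histComplete {hc h : List (Event σ I)}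
    (H : IsCompletionOf hc h) (hnd : h.Nodup) (hcomp : HistComplete h) : hc = h := by
  obtain ⟨-, -, h', r, hsub, hdel, happ, rfl⟩ := H
  have hr : r = [] := List.eq_nil_iff_forall_not_mem.2 fun e he => by
    obtain ⟨m, k, -, hp⟩ := happ e he
    exact hp.2 (hcomp m k hp.1)
  have hle : h ⊆ h' := fun e he => by
    by_contra hne
    obtain ⟨m, k, -, hp⟩ := hdel e he hne
    exact hp.2 (hcomp m k hp.1)
  rw [hr, List.append_nil]
  exact hsub.eq_of_length_le (hnd.subperm hle).length_le

theorem linearizable_nil (V : Type u) (E : Type v) :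
    Linearizable (stackSpec V E) ([] : List (Event (CMethod V E) I)) := by
  refine ⟨[], IsHistory.isCompletionOf_self (IsHistory.of_nodup_isChain ?_ ?_ ?_ ?_) ?_, [], ?_⟩ <;>
    simp [threadEvents, HistComplete, stackSpec, poolSpec, occursBefore_nil, methodList_nil,
      precedes_iff_occursBefore]

theorem linearizable_push (E : Type v) (y : V) (T : I) :
    Linearizable (stackSpec V E)
      [Event.inv (CMethod.ins y) T, Event.res (CMethod.ins y) T] := by
  refine ⟨_, IsHistory.isCompletionOf_self (IsHistory.of_nodup_isChain ?_ ?_ ?_ ?_) ?_,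
    [CMethod.ins y], ?_⟩
  · simp
  · simp [methodList_nil, methodList_inv_cons, methodList_res_cons]
  · simp [occursBefore_cons]
  · intro k
    by_cases hk : T = k <;> simp [threadEvents, Event.thread, hk]
  · simp [HistComplete]
  · simp [stackSpec, poolSpec, occursBefore_nil, occursBefore_cons,
      precedes_iff_occursBefore, methodList_nil, methodList_inv_cons, methodList_res_cons]

theorem linearizable_push_pop (E : Type v) (x : V) (T : I) :
    Linearizable (stackSpec V E)
      [Event.inv (CMethod.ins x) T, Event.res (CMethod.ins x) T,
        Event.inv (CMethod.rem (Sum.inl x)) T, Event.res (CMethod.rem (Sum.inl x)) T] := by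
  refine ⟨_, IsHistory.isCompletionOf_self (IsHistory.of_nodup_isChain ?_ ?_ ?_ ?_) ?_,
    [CMethod.ins x, CMethod.rem (Sum.inl x)], ?_⟩
  · simp
  · simp [methodList_nil, methodList_inv_cons, methodList_res_cons]
  · simp [occursBefore_cons]
  · intro k
    by_cases hk : T = k <;> simp [threadEvents, Event.thread, hk]
  · simp +contextual [HistComplete]
  · simp +contextual [stackSpec, poolSpec, occursBefore_nil, occursBefore_cons,
      precedes_iff_occursBefore, methodList_nil, methodList_inv_cons, methodList_res_cons]

/-- One thread pops `x` before pushing it, while another thread pushes `z` all along. -/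
theorem exists_quiescentConsistent_not_locallyLinearizable
    (V : Type u) (E : Type v) (I : Type w) (x z : V) (hxz : x ≠ z) (T₁ T₂ : I) (hT : T₁ ≠ T₂) :
    ∃ h : List (Event (CMethod V E) I), IsHistory h ∧
      QuiescentConsistent (stackSpec V E) h ∧ ¬ LocallyLinearizable (stackSpec V E) h := by
  let h : List (Event (CMethod V E) I) :=
    [.inv (.ins z) T₂, .inv (.rem (.inl x)) T₁, .res (.rem (.inl x)) T₁,
      .inv (.ins x) T₁, .res (.ins x) T₁, .res (.ins z) T₂]
  have hh : IsHistory h := by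
    refine IsHistory.of_nodup_isChain ?_ ?_ ?_ ?_
    · simp [h, hxz.symm, hxz]
    · simp [h, hxz.symm, methodList_nil, methodList_inv_cons, methodList_res_cons]
    · simp [h, occursBefore_cons]
    · intro k
      by_cases hk : T₁ = k
      · subst hk
        simp [h, threadEvents, Event.thread, hT.symm]
      · by_cases hk' : T₂ = k <;> simp [h, threadEvents, Event.thread, hk, hk']
  have hcomp : HistComplete h := by
    intro m k
    simp only [h, List.mem_cons, List.not_mem_nil, Event.inv.injEq, Event.res.injEq, reduceCtorEq]
    tauto
  refine ⟨h, hh, ⟨h, hh.isCompletionOf_self hcomp,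
    [.ins x, .rem (.inl x), .ins z], ?_, ?_, ?_⟩, ?_⟩
  · simp +contextual [stackSpec, poolSpec, occursBefore_nil, occursBefore_cons, hxz.symm, hxz]
  · simp only [h, methodList_nil, methodList_inv_cons, methodList_res_cons]
    exact (List.reverse_perm _).symm
  · rintro m n ⟨p, hq, ⟨i, k, hip, hi⟩, j, k', hpj, hj⟩
    obtain ⟨l, hlp, hl⟩ := hq ⟨0, by simp [h]⟩ (.ins z) T₂ (by simp; omega) rfl
    have hl5 : l = ⟨5, by simp [h]⟩ := hh.nodup.injective_get hl
    have hj5 : j = ⟨5, by simp [h]⟩ := by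
      have := j.2
      simp only [h, List.length_cons, List.length_nil] at this
      ext
      simp only [hl5] at hlp ⊢
      omega
    rw [hj5] at hj
    simp [h] at hj
  · rintro ⟨hlin, -⟩
    have hind : threadInduced h T₁ =
        [.inv (.rem (.inl x)) T₁, .res (.rem (.inl x)) T₁,
          .inv (.ins x) T₁, .res (.ins x) T₁] := by
      simp [h, threadInduced, InducedMethod, Event.method, hxz.symm, hT]
    have hlin := hlin T₁
    rw [hind] at hlin
    obtain ⟨hc, hcompl, s, hs, hperm, hprec⟩ := hlin
    obtain rfl := hcompl.eq_of_histComplete (by simp) (by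
      intro m k
      simp only [List.mem_cons, List.not_mem_nil, Event.inv.injEq, Event.res.injEq, reduceCtorEq]
      tauto)
    have hmem : CMethod.rem (Sum.inl x) ∈ s := by
      rw [hperm.mem_iff]
      simp [methodList_nil, methodList_inv_cons, methodList_res_cons]
    refine (hs.1.2.1 x hmem).2.asymm hs.1.1 (hprec _ _ ?_)
    exact ⟨⟨1, by simp⟩, ⟨2, by simp⟩, T₁, T₁, by simp, rfl, rfl⟩

/-- The sequential history `push(x)`, `push(y)`, `pop(x)` with the two pushes by
different threads. -/
theorem exists_locallyLinearizable_not_quiescentConsistent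
    (V : Type u) (E : Type v) (I : Type w) (x y : V) (hxy : x ≠ y) (T₁ T₂ : I) (hT : T₁ ≠ T₂) :
    ∃ h : List (Event (CMethod V E) I), IsHistory h ∧
      LocallyLinearizable (stackSpec V E) h ∧ ¬ QuiescentConsistent (stackSpec V E) h := by
  let h : List (Event (CMethod V E) I) :=
    [.inv (.ins x) T₁, .res (.ins x) T₁, .inv (.ins y) T₂, .res (.ins y) T₂,
      .inv (.rem (.inl x)) T₁, .res (.rem (.inl x)) T₁]
  have hh : IsHistory h := by
    refine IsHistory.of_nodup_isChain ?_ ?_ ?_ ?_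
    · simp [h, hxy]
    · simp [h, hxy, methodList_nil, methodList_inv_cons, methodList_res_cons]
    · simp [h, occursBefore_cons]
    · intro k
      by_cases hk : T₁ = k
      · subst hk
        simp [h, threadEvents, Event.thread, hT.symm]
      · by_cases hk' : T₂ = k <;> simp [h, threadEvents, Event.thread, hk, hk']
  have hcomp : HistComplete h := by
    intro m k
    simp only [h, List.mem_cons, List.not_mem_nil, Event.inv.injEq, Event.res.injEq, reduceCtorEq]
    tauto
  refine ⟨h, hh, ⟨fun T => ?_, ?_⟩, ?_⟩
  · by_cases hT₁ : T = T₁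
    · subst hT₁
      convert linearizable_push_pop E x T using 1
      simp [h, threadInduced, InducedMethod, Event.method, hxy.symm, hT]
    · by_cases hT₂ : T = T₂
      · subst hT₂
        convert linearizable_push E y T using 1
        simp [h, threadInduced, InducedMethod, Event.method, hxy, hT.symm]
      · convert linearizable_nil V E using 1
        simp [h, threadInduced, InducedMethod, Event.method, hT₁, hT₂]
  · rintro m ⟨k, hm⟩
    simp only [h, List.mem_cons, List.not_mem_nil, Event.inv.injEq, reduceCtorEq, or_false,
      false_or] at hm
    rcases hm with ⟨rfl, -⟩ | ⟨rfl, -⟩ | ⟨rfl, -⟩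
    · exact ⟨T₁, by simp [InducedMethod, h]⟩
    · exact ⟨T₂, by simp [InducedMethod, h]⟩
    · exact ⟨T₁, by simp [InducedMethod, h]⟩
  · rintro ⟨hc, hcompl, s, hs, hperm, hprec⟩
    obtain rfl := hcompl.eq_of_histComplete hh.nodup hcomp
    have hxys : OccursBefore s (.ins x) (.ins y) := by
      refine hprec _ _ ⟨2, ?_, ⟨⟨1, by simp [h]⟩, T₁, by simp, rfl⟩,
        ⟨2, by simp [h]⟩, T₂, by simp, rfl⟩
      simp +contextual [QuiescentAt, h, Fin.forall_fin_succ, Fin.exists_fin_succ]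
    have hyxs : OccursBefore s (.ins y) (.rem (.inl x)) := by
      refine hprec _ _ ⟨4, ?_, ⟨⟨3, by simp [h]⟩, T₂, by simp, rfl⟩,
        ⟨4, by simp [h]⟩, T₁, by simp, rfl⟩
      simp +contextual [QuiescentAt, h, Fin.forall_fin_succ, Fin.exists_fin_succ]
    have hmem := (hs.2 x y hxys hyxs).1
    rw [hperm.mem_iff] at hmem
    simp [h, hxy.symm, methodList_nil, methodList_inv_cons, methodList_res_cons] at hmem

/-- For stack, local linearizability is incomparable to quiescent consistency. -/
theorem stack_locallyLinearizable_incomparable_quiescentConsistent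
    (V E I : Type*) (x y z : V) (hxy : x ≠ y) (hxz : x ≠ z) (hyz : y ≠ z)
    (T₁ T₂ : I) (hT : T₁ ≠ T₂) :
    (∃ h : List (Event (CMethod V E) I), IsHistory h ∧
        QuiescentConsistent (stackSpec V E) h ∧
        ¬ LocallyLinearizable (stackSpec V E) h) ∧
    (∃ h : List (Event (CMethod V E) I), IsHistory h ∧
        LocallyLinearizable (stackSpec V E) h ∧
        ¬ QuiescentConsistent (stackSpec V E) h) := by
  exact ⟨exists_quiescentConsistent_not_locallyLinearizable V E I x z hxz T₁ T₂ hT,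
    exists_locallyLinearizable_not_quiescentConsistent V E I x y hxy T₁ T₂ hT⟩

end LL
end
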